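/- Let ν = 3, pick points x_1 ∈ P_1, x_2 ∈ P_2, x_3 ∈ P_3, and set 𝔯_pq := Π·(x_p x_q)·Π ∈ ℚ[Sym(Ω)] for p ≠ q. Then [𝔯_23, 𝔯_12] = (1/n_2)·( Ξ[[n_1−1, 0, 1],[1, n_2−1, 0],[0, 1, n_3−1]] − Ξ[[n_1−1, 1, 0],[0, n_2−1, 1],[1, 0, n_3−1]] ). -/

import Mathlib

open Finset

def countMat {Ω : Type} [Fintype Ω] [DecidableEq Ω] {ν : ℕ}
    (P : Fin ν → Finset Ω) (g : Equiv.Perm Ω) (i j : Fin ν) : ℕ :=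
  ((P i).image ⇑g ∩ P j).card

def IsPartition {Ω : Type} [Fintype Ω] {ν : ℕ} (n : Fin ν → ℕ) (P : Fin ν → Finset Ω) : Prop :=
  (∀ i j, i ≠ j → Disjoint (P i) (P j)) ∧ (∀ x : Ω, ∃ j, x ∈ P j) ∧ ∀ j, (P j).card = n j

def youngFinset {Ω : Type} [Fintype Ω] [DecidableEq Ω] {ν : ℕ} (P : Fin ν → Finset Ω) :
    Finset (Equiv.Perm Ω) :=
  Finset.univ.filter (fun g => ∀ j, (P j).image ⇑g = P j)

noncomputable def PiElt {Ω : Type} [Fintype Ω] [DecidableEq Ω] {ν : ℕ}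
    (n : Fin ν → ℕ) (P : Fin ν → Finset Ω) : MonoidAlgebra ℚ (Equiv.Perm Ω) :=
  (∏ j, ((n j).factorial : ℚ))⁻¹ •
    ∑ h ∈ youngFinset P, MonoidAlgebra.of ℚ (Equiv.Perm Ω) h

def xiFinset {Ω : Type} [Fintype Ω] [DecidableEq Ω] {ν : ℕ}
    (P : Fin ν → Finset Ω) (a : Fin ν → Fin ν → ℕ) : Finset (Equiv.Perm Ω) :=
  Finset.univ.filter (fun g => ∀ i j, countMat P g i j = a i j)

noncomputable def muC {ν : ℕ} (n : Fin ν → ℕ) (a : Fin ν → Fin ν → ℕ) : ℚ :=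
  (∏ j, ((n j).factorial : ℚ)) ^ 2 / ∏ i, ∏ j, ((a i j).factorial : ℚ)

noncomputable def XiElt {Ω : Type} [Fintype Ω] [DecidableEq Ω] {ν : ℕ}
    (n : Fin ν → ℕ) (P : Fin ν → Finset Ω) (a : Fin ν → Fin ν → ℕ) :
    MonoidAlgebra ℚ (Equiv.Perm Ω) :=
  (muC n a)⁻¹ • ∑ g ∈ xiFinset P a, MonoidAlgebra.of ℚ (Equiv.Perm Ω) g

/-- `𝔯_pq = Π (x_p x_q) Π`. -/
noncomputable def rFrak {Ω : Type} [Fintype Ω] [DecidableEq Ω] {ν : ℕ}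
    (n : Fin ν → ℕ) (P : Fin ν → Finset Ω) (xp xq : Ω) :
    MonoidAlgebra ℚ (Equiv.Perm Ω) :=
  PiElt n P * MonoidAlgebra.of ℚ (Equiv.Perm Ω) (Equiv.swap xp xq) * PiElt n P

theorem card_filter_eq_one {α : Type*} [Fintype α] [DecidableEq α] {p : α → Prop}
    [DecidablePred p] (y : α) (hp : ∀ z, p z ↔ z = y) : #{z | p z} = 1 :=
  card_eq_one.2 ⟨y, by ext z; simp [hp]⟩

theorem card_perm_comp_eq {α κ : Type*} [Fintype α] [DecidableEq α] [Fintype κ] [DecidableEq κ]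
    (F F' : α → κ) (hFF' : ∀ i, #{x | F' x = i} = #{x | F x = i}) :
    #{k : Equiv.Perm α | ∀ x, F (k x) = F' x} = ∏ i, (#{x | F x = i}).factorial := by
  have e : ∀ i, Nonempty ({x // F' x = i} ≃ {x // F x = i}) := fun i => by
    refine ⟨Fintype.equivOfCardEq ?_⟩
    simpa [Fintype.card_subtype] using hFF' i
  let k₀ : Equiv.Perm α := Equiv.ofFiberEquiv fun i => (e i).some
  have hk₀ : ∀ x, F (k₀ x) = F' x := Equiv.ofFiberEquiv_map _
  have hst := DomMulAct.stabilizer_card F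
  rw [Fintype.card_subtype] at hst
  simp only [Fintype.card_subtype] at hst
  rw [← hst]
  refine Finset.card_bij' (fun k _ => k * k₀⁻¹) (fun k _ => k * k₀) ?_ ?_ ?_ ?_
  · intro k hk
    simp only [mem_filter, mem_univ, true_and] at hk ⊢
    funext x
    simp [hk, ← hk₀]
  · intro k hk
    simp only [mem_filter, mem_univ, true_and] at hk ⊢
    intro x
    rw [← hk₀]
    exact congrFun hk (k₀ x)
  · simp
  · simp

section Young

variable {Ω : Type} [Fintype Ω] {ν : ℕ} {n : Fin ν → ℕ} {P : Fin ν → Finset Ω}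
  {c : Ω → Fin ν}

theorem IsPartition.exists_color (hP : IsPartition n P) :
    ∃ c : Ω → Fin ν, ∀ x j, x ∈ P j ↔ c x = j := by
  choose c hc using hP.2.1
  refine ⟨c, fun x j => ⟨fun hx => ?_, fun h => h ▸ hc x⟩⟩
  by_contra hne
  exact Finset.disjoint_left.mp (hP.1 _ _ hne) (hc x) hx

theorem IsPartition.card_color_eq (hP : IsPartition n P) (hc : ∀ x j, x ∈ P j ↔ c x = j)
    (j : Fin ν) : #{x | c x = j} = n j := by
  rw [← hP.2.2 j]
  congr 1
  ext x
  simp [hc]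

variable [DecidableEq Ω]

theorem mem_youngFinset_iff (hc : ∀ x j, x ∈ P j ↔ c x = j) (h : Equiv.Perm Ω) :
    h ∈ youngFinset P ↔ ∀ x, c (h x) = c x := by
  simp only [youngFinset, mem_filter, mem_univ, true_and]
  constructor
  · intro H x
    rw [← hc, ← H (c x)]
    exact mem_image_of_mem _ ((hc _ _).2 rfl)
  · intro H j
    refine Finset.eq_of_subset_of_card_le ?_ (card_image_of_injective _ h.injective).ge
    intro y hy
    obtain ⟨x, hx, rfl⟩ := mem_image.1 hy
    rw [hc, H, ← hc]
    exact hx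

theorem countMat_eq (hc : ∀ x j, x ∈ P j ↔ c x = j) (g : Equiv.Perm Ω) (i j : Fin ν) :
    countMat P g i j = #{x | c x = i ∧ c (g x) = j} := by
  rw [countMat, ← card_image_of_injective {x | c x = i ∧ c (g x) = j} g.injective]
  congr 1
  ext y
  simp only [mem_inter, mem_image, hc, mem_filter, mem_univ, true_and]
  constructor
  · rintro ⟨⟨x, hx, rfl⟩, hy⟩
    exact ⟨x, ⟨hx, hy⟩, rfl⟩
  · rintro ⟨x, ⟨hx, hy⟩, rfl⟩
    exact ⟨⟨x, hx, rfl⟩, hy⟩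

theorem mem_xiFinset_iff (hc : ∀ x j, x ∈ P j ↔ c x = j) (a : Fin ν → Fin ν → ℕ)
    (g : Equiv.Perm Ω) :
    g ∈ xiFinset P a ↔ ∀ i j, #{x | c x = i ∧ c (g x) = j} = a i j := by
  simp [xiFinset, countMat_eq hc]

theorem IsPartition.card_youngFinset (hP : IsPartition n P) :
    #(youngFinset P) = ∏ j, (n j).factorial := by
  obtain ⟨c, hc⟩ := hP.exists_color
  have : youngFinset P = ({k | ∀ x, c (k x) = c x} : Finset (Equiv.Perm Ω)) := by
    ext h
    simp [mem_youngFinset_iff hc]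
  rw [this, card_perm_comp_eq c c fun _ => rfl]
  exact prod_congr rfl fun j _ => by rw [hP.card_color_eq hc]

theorem mul_mem_youngFinset (hP : IsPartition n P) {h k : Equiv.Perm Ω} (hh : h ∈ youngFinset P)
    (hk : k ∈ youngFinset P) : h * k ∈ youngFinset P := by
  obtain ⟨c, hc⟩ := hP.exists_color
  rw [mem_youngFinset_iff hc] at *
  simp [hh, hk]

theorem inv_mem_youngFinset (hP : IsPartition n P) {h : Equiv.Perm Ω} (hh : h ∈ youngFinset P) :
    h⁻¹ ∈ youngFinset P := by
  obtain ⟨c, hc⟩ := hP.exists_color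
  rw [mem_youngFinset_iff hc] at *
  intro x
  simpa using (hh (h⁻¹ x)).symm

theorem PiElt_mul_of (hP : IsPartition n P) {h : Equiv.Perm Ω} (hh : h ∈ youngFinset P) :
    PiElt n P * MonoidAlgebra.of ℚ (Equiv.Perm Ω) h = PiElt n P := by
  rw [PiElt, smul_mul_assoc, sum_mul]
  congr 1
  refine sum_bij' (fun k _ => k * h) (fun k _ => k * h⁻¹) ?_ ?_ ?_ ?_ ?_
  · exact fun k hk => mul_mem_youngFinset hP hk hh
  · exact fun k hk => mul_mem_youngFinset hP hk (inv_mem_youngFinset hP hh)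
  · simp
  · simp
  · exact fun k _ => (map_mul _ k h).symm

theorem PiElt_mul_self (hP : IsPartition n P) : PiElt n P * PiElt n P = PiElt n P := by
  have hne : (∏ j, ((n j).factorial : ℚ)) ≠ 0 :=
    prod_ne_zero_iff.2 fun j _ => by exact_mod_cast (n j).factorial_ne_zero
  conv_lhs => enter [2]; rw [PiElt]
  rw [mul_smul_comm, mul_sum, sum_congr rfl fun h hh => PiElt_mul_of hP hh, sum_const,
    hP.card_youngFinset, ← Nat.cast_smul_eq_nsmul ℚ, smul_smul]
  push_cast
  rw [inv_mul_cancel₀ hne, one_smul]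

theorem card_young_mul_mul_eq (hP : IsPartition n P) {a : Fin ν → Fin ν → ℕ} {g g' : Equiv.Perm Ω}
    (hg : g ∈ xiFinset P a) (hg' : g' ∈ xiFinset P a) :
    #{p ∈ youngFinset P ×ˢ youngFinset P | p.1 * g * p.2 = g'} =
      ∏ i, ∏ j, (a i j).factorial := by
  obtain ⟨c, hc⟩ := hP.exists_color
  rw [mem_xiFinset_iff hc] at hg hg'
  have key := card_perm_comp_eq (fun x => (c x, c (g x))) (fun x => (c x, c (g' x))) (by
    rintro ⟨i, j⟩
    simp only [Prod.mk.injEq, hg, hg'])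
  rw [Fintype.prod_prod_type] at key
  simp only [Prod.mk.injEq, hg] at key
  rw [← key]
  refine card_bij' (fun p _ => p.2) (fun k _ => (g' * k⁻¹ * g⁻¹, k)) ?_ ?_ ?_ ?_
  · rintro ⟨h, k⟩ hp
    simp only [mem_filter, mem_product, mem_youngFinset_iff hc] at hp
    simp only [mem_filter, mem_univ, true_and]
    refine fun x => ⟨hp.1.2 x, ?_⟩
    rw [← hp.2]
    exact (hp.1.1 _).symm
  · intro k hk
    simp only [mem_filter, mem_univ, true_and] at hk
    simp only [mem_filter, mem_product, mem_youngFinset_iff hc]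
    refine ⟨⟨fun x => ?_, fun x => (hk x).1⟩, by group⟩
    simpa using (hk (k⁻¹ (g⁻¹ x))).2.symm
  · rintro ⟨h, k⟩ hp
    simp only [mem_filter] at hp
    rw [← hp.2]
    ext1 <;> simp [mul_assoc]
  · simp

theorem mul_mul_mem_xiFinset (hP : IsPartition n P) {a : Fin ν → Fin ν → ℕ} {g h k : Equiv.Perm Ω}
    (hg : g ∈ xiFinset P a) (hh : h ∈ youngFinset P) (hk : k ∈ youngFinset P) :
    h * g * k ∈ xiFinset P a := by
  obtain ⟨c, hc⟩ := hP.exists_color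
  rw [mem_youngFinset_iff hc] at hh hk
  rw [mem_xiFinset_iff hc] at hg ⊢
  intro i j
  rw [← hg, ← card_image_of_injective {x | c x = i ∧ c ((h * g * k) x) = j} k.injective]
  congr 1
  ext y
  simp only [mem_image, mem_filter, mem_univ, true_and, Equiv.Perm.mul_apply, hh]
  constructor
  · rintro ⟨x, hx, rfl⟩
    rwa [hk]
  · intro hy
    refine ⟨k⁻¹ y, ?_, by simp⟩
    have := hk (k⁻¹ y)
    simp_all

/-- The double coset average `Π g Π` depends only on the intersection numbers of `g`. -/
theorem PiElt_mul_of_mul_PiElt (hP : IsPartition n P) {a : Fin ν → Fin ν → ℕ} {g : Equiv.Perm Ω}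
    (hg : g ∈ xiFinset P a) :
    PiElt n P * MonoidAlgebra.of ℚ (Equiv.Perm Ω) g * PiElt n P = XiElt n P a := by
  rw [PiElt, XiElt, smul_mul_assoc, smul_mul_assoc, mul_smul_comm, smul_smul, sum_mul,
    sum_mul_sum, ← sum_product']
  have hmaps : ∀ p ∈ youngFinset P ×ˢ youngFinset P, p.1 * g * p.2 ∈ xiFinset P a :=
    fun p hp => mul_mul_mem_xiFinset hP hg (mem_product.1 hp).1 (mem_product.1 hp).2
  rw [← sum_fiberwise_of_maps_to hmaps]
  have hfib : ∀ g' ∈ xiFinset P a,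
      ∑ p ∈ youngFinset P ×ˢ youngFinset P with p.1 * g * p.2 = g',
        MonoidAlgebra.of ℚ (Equiv.Perm Ω) p.1 * MonoidAlgebra.of ℚ (Equiv.Perm Ω) g *
          MonoidAlgebra.of ℚ (Equiv.Perm Ω) p.2 =
      (∏ i, ∏ j, ((a i j).factorial : ℚ)) • MonoidAlgebra.of ℚ (Equiv.Perm Ω) g' := by
    intro g' hg'
    rw [sum_congr rfl (g := fun _ => MonoidAlgebra.of ℚ (Equiv.Perm Ω) g'), sum_const,
      card_young_mul_mul_eq hP hg hg', ← Nat.cast_smul_eq_nsmul ℚ]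
    · push_cast
      rfl
    · intro p hp
      rw [← map_mul, ← map_mul, (mem_filter.1 hp).2]
  rw [sum_congr rfl hfib, ← smul_sum, smul_smul, muC]
  congr 1
  rw [inv_div]
  ring

theorem rFrak_mul_rFrak (hP : IsPartition n P) (x y z w : Ω) :
    rFrak n P x y * rFrak n P z w =
      (∏ j, ((n j).factorial : ℚ))⁻¹ • ∑ h ∈ youngFinset P,
        PiElt n P * MonoidAlgebra.of ℚ (Equiv.Perm Ω) (Equiv.swap x y * h * Equiv.swap z w) *
          PiElt n P := by
  have : rFrak n P x y * rFrak n P z w =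
      PiElt n P * MonoidAlgebra.of ℚ _ (Equiv.swap x y) * PiElt n P *
        (MonoidAlgebra.of ℚ _ (Equiv.swap z w) * PiElt n P) := by
    rw [rFrak, rFrak]
    conv_rhs => rw [← PiElt_mul_self hP]
    simp only [mul_assoc, PiElt_mul_self hP]
    simp only [← mul_assoc, PiElt_mul_self hP]
  rw [this]
  conv_lhs => enter [1, 2]; rw [PiElt]
  rw [mul_smul_comm, smul_mul_assoc, mul_sum, sum_mul]
  congr 1
  refine sum_congr rfl fun h _ => ?_
  simp only [map_mul, mul_assoc]

theorem card_youngFinset_fixing (hP : IsPartition n P) {j : Fin ν} {x : Ω} (hx : x ∈ P j) :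
    n j * #{h ∈ youngFinset P | h x = x} = ∏ j, (n j).factorial := by
  obtain ⟨c, hc⟩ := hP.exists_color
  have hmaps : ∀ h ∈ youngFinset P, h x ∈ P j := by
    intro h hh
    rw [mem_youngFinset_iff hc] at hh
    rw [hc] at hx ⊢
    rw [hh, hx]
  rw [← hP.card_youngFinset, card_eq_sum_card_fiberwise hmaps, ← hP.2.2 j, ← smul_eq_mul,
    ← sum_const]
  refine sum_congr rfl fun y hy => ?_
  have hs : Equiv.swap x y ∈ youngFinset P := by
    rw [mem_youngFinset_iff hc]
    rw [hc] at hx hy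
    grind
  refine card_bij' (fun h _ => Equiv.swap x y * h) (fun h _ => Equiv.swap x y * h) ?_ ?_ ?_ ?_
  · intro h hh
    simp only [mem_filter] at hh ⊢
    exact ⟨mul_mem_youngFinset hP hs hh.1, by simp [hh.2]⟩
  · intro h hh
    simp only [mem_filter] at hh ⊢
    exact ⟨mul_mem_youngFinset hP hs hh.1, by simp [hh.2]⟩
  · simp [← mul_assoc]
  · simp [← mul_assoc]

end Young

theorem mem_xiFinset_of_offDiag {Ω : Type} [Fintype Ω] [DecidableEq Ω] {n : Fin 3 → ℕ}
    {P : Fin 3 → Finset Ω} (hP : IsPartition n P) {c : Ω → Fin 3}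
    (hc : ∀ x j, x ∈ P j ↔ c x = j) (g : Equiv.Perm Ω) {a : Fin 3 → Fin 3 → ℕ}
    (ha : ∀ i, ∑ j, a i j = n i)
    (hg : ∀ i j, i ≠ j → #{x | c x = i ∧ c (g x) = j} = a i j) : g ∈ xiFinset P a := by
  rw [mem_xiFinset_iff hc]
  have hrow : ∀ i, ∑ j, #{x | c x = i ∧ c (g x) = j} = ∑ j, a i j := by
    intro i
    rw [ha, ← hP.card_color_eq hc i,
      card_eq_sum_card_fiberwise (f := fun x => c (g x)) (t := univ) (by simp)]
    simp only [filter_filter]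
  intro i j
  by_cases hij : i = j
  · subst hij
    have h1 := hrow i
    rw [← add_sum_erase _ _ (mem_univ i),
      ← add_sum_erase _ (fun j => a i j) (mem_univ i),
      sum_congr rfl fun j hj => hg i j (ne_of_mem_erase hj).symm] at h1
    exact Nat.add_right_cancel h1
  · exact hg i j hij

section ThreeBlocks

variable {Ω : Type} [Fintype Ω] [DecidableEq Ω] {n : Fin 3 → ℕ} {P : Fin 3 → Finset Ω}
  {x : Fin 3 → Ω} {h : Equiv.Perm Ω}

theorem swap_mul_mul_swap_mem_of_fixed (hn : ∀ j, 1 ≤ n j) (hP : IsPartition n P)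
    (hx : ∀ p, x p ∈ P p) (hh : h ∈ youngFinset P) (hfix : h (x 1) = x 1) :
    Equiv.swap (x 1) (x 2) * h * Equiv.swap (x 0) (x 1) ∈
      xiFinset P ![![n 0 - 1, 0, 1], ![1, n 1 - 1, 0], ![0, 1, n 2 - 1]] := by
  obtain ⟨c, hc⟩ := hP.exists_color
  simp only [hc] at hx
  rw [mem_youngFinset_iff hc] at hh
  have h0 := hx 0
  have h1 := hx 1
  have h2 := hx 2
  obtain ⟨u, hueq⟩ := h.surjective (x 2)
  have hcu : c u = 2 := by rw [← hh, hueq, hx]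
  have hu : ∀ z, h z = x 2 ↔ z = u := fun z => by rw [← hueq, h.injective.eq_iff]
  have hΦ : ∀ z, c ((Equiv.swap (x 1) (x 2) * h * Equiv.swap (x 0) (x 1)) z) =
      if z = x 0 then 2 else if z = x 1 then 0 else if z = u then 1 else c z := by
    intro z
    have hw : ∀ z, h z = x 1 ↔ z = x 1 := fun z => by
      conv_lhs => rw [← hfix, h.injective.eq_iff]
    simp only [Equiv.Perm.mul_apply, Equiv.swap_apply_def]
    grind
  refine mem_xiFinset_of_offDiag hP hc _ ?_ ?_
  · have := hn 0; have := hn 1; have := hn 2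
    intro i
    fin_cases i <;> simp [Fin.sum_univ_three] <;> omega
  · simp only [hΦ]
    clear hΦ hc hh
    intro i j hij
    fin_cases i <;> fin_cases j <;> simp at hij ⊢
    · grind
    · exact card_filter_eq_one (x 0) fun z => by grind
    · exact card_filter_eq_one (x 1) fun z => by grind
    · grind
    · grind
    · exact card_filter_eq_one u fun z => by grind

theorem swap_mul_mul_swap_mem_of_fixed' (hn : ∀ j, 1 ≤ n j) (hP : IsPartition n P)
    (hx : ∀ p, x p ∈ P p) (hh : h ∈ youngFinset P) (hfix : h (x 1) = x 1) :
    Equiv.swap (x 0) (x 1) * h * Equiv.swap (x 1) (x 2) ∈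
      xiFinset P ![![n 0 - 1, 1, 0], ![0, n 1 - 1, 1], ![1, 0, n 2 - 1]] := by
  obtain ⟨c, hc⟩ := hP.exists_color
  simp only [hc] at hx
  rw [mem_youngFinset_iff hc] at hh
  have h0 := hx 0
  have h1 := hx 1
  have h2 := hx 2
  obtain ⟨u, hueq⟩ := h.surjective (x 0)
  have hcu : c u = 0 := by rw [← hh, hueq, hx]
  have hu : ∀ z, h z = x 0 ↔ z = u := fun z => by rw [← hueq, h.injective.eq_iff]
  have hΦ : ∀ z, c ((Equiv.swap (x 0) (x 1) * h * Equiv.swap (x 1) (x 2)) z) =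
      if z = x 2 then 0 else if z = x 1 then 2 else if z = u then 1 else c z := by
    intro z
    have hw : ∀ z, h z = x 1 ↔ z = x 1 := fun z => by
      conv_lhs => rw [← hfix, h.injective.eq_iff]
    simp only [Equiv.Perm.mul_apply, Equiv.swap_apply_def]
    grind
  refine mem_xiFinset_of_offDiag hP hc _ ?_ ?_
  · have := hn 0; have := hn 1; have := hn 2
    intro i
    fin_cases i <;> simp [Fin.sum_univ_three] <;> omega
  · simp only [hΦ]
    clear hΦ hc hh
    intro i j hij
    fin_cases i <;> fin_cases j <;> simp at hij ⊢
    · exact card_filter_eq_one u fun z => by grind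
    · grind
    · grind
    · exact card_filter_eq_one (x 1) fun z => by grind
    · exact card_filter_eq_one (x 2) fun z => by grind
    · grind

theorem two_le_of_not_fixed (hP : IsPartition n P) (hx : ∀ p, x p ∈ P p)
    (hh : h ∈ youngFinset P) (hfix : h (x 1) ≠ x 1) : 2 ≤ n 1 := by
  obtain ⟨c, hc⟩ := hP.exists_color
  rw [mem_youngFinset_iff hc] at hh
  rw [← hP.2.2 1]
  refine one_lt_card.2 ⟨h (x 1), ?_, x 1, hx 1, hfix⟩
  rw [hc, hh, ← hc]
  exact hx 1

theorem swap_mul_mul_swap_mem_of_not_fixed (hn : ∀ j, 1 ≤ n j) (hP : IsPartition n P)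
    (hx : ∀ p, x p ∈ P p) (hh : h ∈ youngFinset P) (hfix : h (x 1) ≠ x 1) :
    Equiv.swap (x 1) (x 2) * h * Equiv.swap (x 0) (x 1) ∈
      xiFinset P ![![n 0 - 1, 1, 0], ![1, n 1 - 2, 1], ![0, 1, n 2 - 1]] := by
  have hn1 := two_le_of_not_fixed hP hx hh hfix
  obtain ⟨c, hc⟩ := hP.exists_color
  simp only [hc] at hx
  rw [mem_youngFinset_iff hc] at hh
  have h0 := hx 0
  have h1 := hx 1
  have h2 := hx 2
  obtain ⟨u, hueq⟩ := h.surjective (x 2)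
  have hcu : c u = 2 := by rw [← hh, hueq, hx]
  have hu : ∀ z, h z = x 2 ↔ z = u := fun z => by rw [← hueq, h.injective.eq_iff]
  obtain ⟨v, hveq⟩ := h.surjective (x 1)
  have hcv : c v = 1 := by rw [← hh, hveq, hx]
  have hv : ∀ z, h z = x 1 ↔ z = v := fun z => by rw [← hveq, h.injective.eq_iff]
  have hΦ : ∀ z, c ((Equiv.swap (x 1) (x 2) * h * Equiv.swap (x 0) (x 1)) z) =
      if z = x 0 then 1 else if z = x 1 then 0 else if z = v then 2
        else if z = u then 1 else c z := by
    intro z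
    simp only [Equiv.Perm.mul_apply, Equiv.swap_apply_def]
    grind
  refine mem_xiFinset_of_offDiag hP hc _ ?_ ?_
  · have := hn 0; have := hn 2
    intro i
    fin_cases i <;> simp [Fin.sum_univ_three] <;> omega
  · simp only [hΦ]
    clear hΦ hc hh
    intro i j hij
    fin_cases i <;> fin_cases j <;> simp at hij ⊢
    · exact card_filter_eq_one (x 0) fun z => by grind
    · grind
    · exact card_filter_eq_one (x 1) fun z => by grind
    · exact card_filter_eq_one v fun z => by grind
    · grind
    · exact card_filter_eq_one u fun z => by by_cases z = x 0 <;> grind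

theorem swap_mul_mul_swap_mem_of_not_fixed' (hn : ∀ j, 1 ≤ n j) (hP : IsPartition n P)
    (hx : ∀ p, x p ∈ P p) (hh : h ∈ youngFinset P) (hfix : h (x 1) ≠ x 1) :
    Equiv.swap (x 0) (x 1) * h * Equiv.swap (x 1) (x 2) ∈
      xiFinset P ![![n 0 - 1, 1, 0], ![1, n 1 - 2, 1], ![0, 1, n 2 - 1]] := by
  have hn1 := two_le_of_not_fixed hP hx hh hfix
  obtain ⟨c, hc⟩ := hP.exists_color
  simp only [hc] at hx
  rw [mem_youngFinset_iff hc] at hh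
  have h0 := hx 0
  have h1 := hx 1
  have h2 := hx 2
  obtain ⟨u, hueq⟩ := h.surjective (x 0)
  have hcu : c u = 0 := by rw [← hh, hueq, hx]
  have hu : ∀ z, h z = x 0 ↔ z = u := fun z => by rw [← hueq, h.injective.eq_iff]
  obtain ⟨v, hveq⟩ := h.surjective (x 1)
  have hcv : c v = 1 := by rw [← hh, hveq, hx]
  have hv : ∀ z, h z = x 1 ↔ z = v := fun z => by rw [← hveq, h.injective.eq_iff]
  have hΦ : ∀ z, c ((Equiv.swap (x 0) (x 1) * h * Equiv.swap (x 1) (x 2)) z) =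
      if z = x 2 then 1 else if z = x 1 then 2 else if z = v then 0
        else if z = u then 1 else c z := by
    intro z
    simp only [Equiv.Perm.mul_apply, Equiv.swap_apply_def]
    grind
  refine mem_xiFinset_of_offDiag hP hc _ ?_ ?_
  · have := hn 0; have := hn 2
    intro i
    fin_cases i <;> simp [Fin.sum_univ_three] <;> omega
  · simp only [hΦ]
    clear hΦ hc hh
    intro i j hij
    fin_cases i <;> fin_cases j <;> simp at hij ⊢
    · exact card_filter_eq_one u fun z => by by_cases z = x 2 <;> grind
    · grind
    · exact card_filter_eq_one v fun z => by grind
    · exact card_filter_eq_one (x 1) fun z => by grind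
    · grind
    · exact card_filter_eq_one (x 2) fun z => by grind

end ThreeBlocks

theorem stmt10 (n : Fin 3 → ℕ) (hn : ∀ j, 1 ≤ n j)
    (Ω : Type) [Fintype Ω] [DecidableEq Ω] (P : Fin 3 → Finset Ω)
    (hP : IsPartition n P)
    (x : Fin 3 → Ω) (hx : ∀ p, x p ∈ P p) :
    rFrak n P (x 1) (x 2) * rFrak n P (x 0) (x 1) -
        rFrak n P (x 0) (x 1) * rFrak n P (x 1) (x 2) =
      ((n 1 : ℚ))⁻¹ •
        (XiElt n P ![![n 0 - 1, 0, 1], ![1, n 1 - 1, 0], ![0, 1, n 2 - 1]] -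
         XiElt n P ![![n 0 - 1, 1, 0], ![0, n 1 - 1, 1], ![1, 0, n 2 - 1]]) := by
  have hterm : ∀ h ∈ youngFinset P,
      PiElt n P * MonoidAlgebra.of ℚ (Equiv.Perm Ω)
          (Equiv.swap (x 1) (x 2) * h * Equiv.swap (x 0) (x 1)) * PiElt n P -
        PiElt n P * MonoidAlgebra.of ℚ (Equiv.Perm Ω)
          (Equiv.swap (x 0) (x 1) * h * Equiv.swap (x 1) (x 2)) * PiElt n P =
      if h (x 1) = x 1 then
        XiElt n P ![![n 0 - 1, 0, 1], ![1, n 1 - 1, 0], ![0, 1, n 2 - 1]] -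
          XiElt n P ![![n 0 - 1, 1, 0], ![0, n 1 - 1, 1], ![1, 0, n 2 - 1]]
      else 0 := by
    intro h hh
    split_ifs with hfix
    · rw [PiElt_mul_of_mul_PiElt hP (swap_mul_mul_swap_mem_of_fixed hn hP hx hh hfix),
        PiElt_mul_of_mul_PiElt hP (swap_mul_mul_swap_mem_of_fixed' hn hP hx hh hfix)]
    · rw [PiElt_mul_of_mul_PiElt hP (swap_mul_mul_swap_mem_of_not_fixed hn hP hx hh hfix),
        PiElt_mul_of_mul_PiElt hP (swap_mul_mul_swap_mem_of_not_fixed' hn hP hx hh hfix),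
        sub_self]
  rw [rFrak_mul_rFrak hP, rFrak_mul_rFrak hP, ← smul_sub, ← sum_sub_distrib,
    sum_congr rfl hterm, ← sum_filter, sum_const, ← Nat.cast_smul_eq_nsmul ℚ, smul_smul]
  congr 1
  have hcard : (n 1 : ℚ) * #{h ∈ youngFinset P | h (x 1) = x 1} =
      ∏ j, ((n j).factorial : ℚ) := by
    exact_mod_cast card_youngFinset_fixing hP (hx 1)
  have hne : (∏ j, ((n j).factorial : ℚ)) ≠ 0 :=
    prod_ne_zero_iff.2 fun j _ => by exact_mod_cast (n j).factorial_ne_zero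
  have hn1 : (n 1 : ℚ) ≠ 0 := by
    have := hn 1
    positivity
  rw [inv_mul_eq_div, div_eq_iff hne, ← hcard, inv_mul_cancel_left₀ hn1]
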